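/- arXiv:2012.08265 — 2 statements merged into one kernel-verified Lean document; each statement's English description precedes it below -/
import Mathlib

section
/- Let M be exponentially distributed with parameter λ > 0 and b ∈ ℝ. There exists m > 0 satisfying the two-bin equilibrium equation m = (E[M | M < m] + E[M | M ≥ m])/2 + b — equivalently (m/2)·e^{λm}/(e^{λm} − 1) = 1/λ + b — if and only if b > −1/(2λ). In particular, if b ≤ −1/(2λ) the only equilibrium is the non-informative one. -/
open MeasureTheory Set Filter

/-- Conditional mean `E[M | M ∈ s]` of a random variable with density `f`. -/
noncomputable def condMean (f : ℝ → ℝ) (s : Set ℝ) : ℝ :=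
  (∫ x in s, x * f x) / (∫ x in s, f x)

/-- The bin (interval) of real numbers between two extended-real edges `lo` and `hi`. -/
def ebin (lo hi : EReal) : Set ℝ := {x : ℝ | lo ≤ (x : EReal) ∧ (x : EReal) < hi}

/-- Edges `m_0 = m_L < m_1 < ⋯ < m_{N−1} < m_N = +∞` of an `N`-bin quantizer with interior
edges `m : Fin (N−1) → ℝ`, for a source supported on `[m_L, ∞)`. -/
noncomputable def edgesL (mL : ℝ) (N : ℕ) (m : Fin (N - 1) → ℝ) (k : ℕ) : EReal :=
  if hk : k = 0 then (mL : EReal)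
  else if h : k ≤ N - 1 then ((m ⟨k - 1, by omega⟩ : ℝ) : EReal)
  else ⊤

/-- `m : Fin (N−1) → ℝ` is the vector of interior edges of an `N`-bin cheap-talk equilibrium
for a source with density `f` supported on `[m_L, ∞)` and bias `b`: the interior edges are
strictly increasing, lie above `m_L`, and every interior edge `m_k` satisfies the
centroid/nearest-neighbor condition
`m_k = (E[M | m_{k−1} ≤ M < m_k] + E[M | m_k ≤ M < m_{k+1}])/2 + b`. -/
def IsEqL (f : ℝ → ℝ) (mL b : ℝ) (N : ℕ) (m : Fin (N - 1) → ℝ) : Prop :=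
  StrictMono m ∧ (∀ k, mL < m k) ∧ ∀ k : Fin (N - 1),
    m k = (condMean f (ebin (edgesL mL N m k.val) (edgesL mL N m (k.val + 1)))
         + condMean f (ebin (edgesL mL N m (k.val + 1)) (edgesL mL N m (k.val + 2)))) / 2 + b

/-- The exponential density with rate `lam`: `f(x) = λ e^{−λx}` for `x ≥ 0`, `0` otherwise. -/
noncomputable def expPDF (lam : ℝ) (x : ℝ) : ℝ :=
  if 0 ≤ x then lam * Real.exp (-lam * x) else 0

/-- An antiderivative of `λ e^{−λx}`. -/
theorem hasDerivAt_neg_exp_neg_mul (lam x : ℝ) :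
    HasDerivAt (fun x => -Real.exp (-lam * x)) (lam * Real.exp (-lam * x)) x := by
  convert! ((hasDerivAt_id x).const_mul (-lam)).exp.neg using 1
  simp only [id_eq]
  ring

/-- An antiderivative of `x λ e^{−λx}`. -/
theorem hasDerivAt_neg_add_inv_mul_exp_neg_mul {lam : ℝ} (hlam : lam ≠ 0) (x : ℝ) :
    HasDerivAt (fun x => -((x + 1 / lam) * Real.exp (-lam * x)))
      (x * (lam * Real.exp (-lam * x))) x := by
  convert! (((hasDerivAt_id x).add_const (1 / lam)).mul
    ((hasDerivAt_id x).const_mul (-lam)).exp).neg using 1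
  simp only [id_eq]
  field_simp
  ring

theorem tendsto_neg_exp_neg_mul_atTop {lam : ℝ} (hlam : 0 < lam) :
    Tendsto (fun x => -Real.exp (-lam * x)) atTop (nhds 0) := by
  have h : Tendsto (fun x => -lam * x) atTop atBot :=
    tendsto_id.const_mul_atTop_of_neg (by linarith)
  simpa using (Real.tendsto_exp_atBot.comp h).neg

theorem tendsto_neg_add_inv_mul_exp_neg_mul_atTop {lam : ℝ} (hlam : 0 < lam) :
    Tendsto (fun x => -((x + 1 / lam) * Real.exp (-lam * x))) atTop (nhds 0) := by
  have h₁ : Tendsto (fun x => x * Real.exp (-lam * x)) atTop (nhds 0) := by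
    simpa using tendsto_rpow_mul_exp_neg_mul_atTop_nhds_zero 1 lam hlam
  have h₂ := (tendsto_neg_exp_neg_mul_atTop hlam).const_mul (1 / lam)
  convert! h₂.sub h₁ using 1
  · ext x; ring
  · simp

theorem setIntegral_mul_expPDF_Ici {lam a : ℝ} (ha : 0 ≤ a) (g : ℝ → ℝ) :
    ∫ x in Ici a, g x * expPDF lam x = ∫ x in Ioi a, g x * (lam * Real.exp (-lam * x)) := by
  rw [integral_Ici_eq_integral_Ioi]
  refine setIntegral_congr_fun measurableSet_Ioi fun x hx => ?_
  simp [expPDF, ha.trans (mem_Ioi.1 hx).le]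

theorem setIntegral_mul_expPDF_Iio {lam m : ℝ} (hm : 0 ≤ m) (g : ℝ → ℝ) :
    ∫ x in Iio m, g x * expPDF lam x = ∫ x in 0..m, g x * (lam * Real.exp (-lam * x)) := by
  rw [intervalIntegral.integral_of_le hm, ← integral_Ico_eq_integral_Ioc,
    setIntegral_eq_of_subset_of_forall_sdiff_eq_zero (s := Ico 0 m)
      measurableSet_Iio Ico_subset_Iio_self]
  · refine setIntegral_congr_fun measurableSet_Ico fun x hx => ?_
    simp [expPDF, hx.1]
  · rintro x ⟨hx, hx'⟩
    have h : ¬ 0 ≤ x := fun h => hx' ⟨h, hx⟩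
    simp [expPDF, h]

theorem condMean_expPDF_Ici {lam m : ℝ} (hlam : 0 < lam) (hm : 0 ≤ m) :
    condMean (expPDF lam) (Ici m) = m + 1 / lam := by
  have hmass : ∫ x in Ici m, expPDF lam x = Real.exp (-lam * m) := by
    have h := setIntegral_mul_expPDF_Ici (lam := lam) hm fun _ => 1
    simp only [one_mul] at h
    rw [h, integral_Ioi_of_hasDerivAt_of_nonneg'
      (fun x _ => hasDerivAt_neg_exp_neg_mul lam x) (fun x _ => by positivity)
      (tendsto_neg_exp_neg_mul_atTop hlam)]
    ring
  have hmean : ∫ x in Ici m, x * expPDF lam x = (m + 1 / lam) * Real.exp (-lam * m) := by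
    rw [setIntegral_mul_expPDF_Ici hm fun x => x, integral_Ioi_of_hasDerivAt_of_nonneg'
      (fun x _ => hasDerivAt_neg_add_inv_mul_exp_neg_mul hlam.ne' x)
      (fun x hx => by have := hm.trans (mem_Ioi.1 hx).le; positivity)
      (tendsto_neg_add_inv_mul_exp_neg_mul_atTop hlam)]
    ring
  rw [condMean, hmass, hmean, mul_div_cancel_right₀ _ (Real.exp_ne_zero _)]

theorem condMean_expPDF_Iio {lam m : ℝ} (hlam : 0 < lam) (hm : 0 ≤ m) :
    condMean (expPDF lam) (Iio m) =
      (1 / lam - (m + 1 / lam) * Real.exp (-lam * m)) / (1 - Real.exp (-lam * m)) := by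
  have hmass : ∫ x in Iio m, expPDF lam x = 1 - Real.exp (-lam * m) := by
    have h := setIntegral_mul_expPDF_Iio (lam := lam) hm fun _ => 1
    simp only [one_mul] at h
    rw [h, intervalIntegral.integral_eq_sub_of_hasDerivAt
      (fun x _ => hasDerivAt_neg_exp_neg_mul lam x)
      (Continuous.intervalIntegrable (by fun_prop) _ _)]
    simp
    ring
  have hmean : ∫ x in Iio m, x * expPDF lam x =
      1 / lam - (m + 1 / lam) * Real.exp (-lam * m) := by
    rw [setIntegral_mul_expPDF_Iio hm fun x => x, intervalIntegral.integral_eq_sub_of_hasDerivAt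
      (fun x _ => hasDerivAt_neg_add_inv_mul_exp_neg_mul hlam.ne' x)
      (Continuous.intervalIntegrable (by fun_prop) _ _)]
    simp
    ring
  rw [condMean, hmass, hmean]

theorem exp_twoBin_equation_iff {lam b m : ℝ} (hlam : 0 < lam) (hm : 0 < m) :
    m = (condMean (expPDF lam) (Iio m) + condMean (expPDF lam) (Ici m)) / 2 + b ↔
      m = 2 * (1 / lam + b) * (1 - Real.exp (-lam * m)) := by
  have hE : 1 - Real.exp (-lam * m) ≠ 0 := by
    have : Real.exp (-lam * m) < 1 := Real.exp_lt_one_iff.2 (by nlinarith)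
    linarith
  rw [condMean_expPDF_Ici hlam hm.le, condMean_expPDF_Iio hlam hm.le]
  generalize Real.exp (-lam * m) = E at *
  have key : (1 / lam - (m + 1 / lam) * E) / (1 - E) = 1 / lam + m - m / (1 - E) := by
    field_simp
    ring
  have hdiv : m = 2 * (1 / lam + b) * (1 - E) ↔ m / (1 - E) = 2 * (1 / lam + b) :=
    (div_eq_iff hE).symm
  rw [key, hdiv]
  constructor <;> intro h <;> linarith

/-- For `c > 0`, the map `m ↦ c (1 − e^{−λm})` has a positive fixed point if and only if its
slope at the origin exceeds one. -/
theorem exists_pos_eq_mul_one_sub_exp_iff {lam c : ℝ} (hlam : 0 < lam) :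
    (∃ m : ℝ, 0 < m ∧ m = c * (1 - Real.exp (-lam * m))) ↔ 1 < c * lam := by
  constructor
  · rintro ⟨m, hm, h⟩
    have hlm : 0 < lam * m := mul_pos hlam hm
    have h₁ : -lam * m + 1 < Real.exp (-lam * m) := Real.add_one_lt_exp (by nlinarith)
    have h₂ : Real.exp (-lam * m) < 1 := Real.exp_lt_one_iff.2 (by linarith)
    have hc : 0 < c := by
      by_contra! hc
      nlinarith
    nlinarith
  · intro h
    have hc : 0 < c := pos_of_mul_pos_left (by linarith) hlam.le
    set a := c - 1 / lam with ha_def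
    have hla : lam * a = c * lam - 1 := by rw [ha_def]; field_simp
    have ha : 0 < a := pos_of_mul_pos_right (by linarith : 0 < lam * a) hlam.le
    have hac : a ≤ c := sub_le_self c (by positivity)
    have hcont : ContinuousOn (fun m => m - c * (1 - Real.exp (-lam * m))) (Icc a c) := by
      fun_prop
    have hleft : a - c * (1 - Real.exp (-lam * a)) ≤ 0 := by
      have h₁ : lam * a + 1 ≤ Real.exp (lam * a) := Real.add_one_le_exp _
      have h₂ : Real.exp (-lam * a) * Real.exp (lam * a) = 1 := by
        rw [← Real.exp_add]; simp
      have h₃ := Real.exp_pos (-lam * a)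
      have h₄ : Real.exp (-lam * a) * (c * lam) ≤ 1 := by nlinarith
      have h₅ : c * Real.exp (-lam * a) ≤ 1 / lam := by
        rw [le_div_iff₀ hlam]; linarith
      linarith
    have hright : 0 ≤ c - c * (1 - Real.exp (-lam * c)) := by
      have := mul_pos hc (Real.exp_pos (-lam * c))
      linarith
    obtain ⟨m, hm, hm₀⟩ := intermediate_value_Icc hac hcont ⟨hleft, hright⟩
    exact ⟨m, ha.trans_le hm.1, sub_eq_zero.1 hm₀⟩

/-- For an exponential source with parameter `λ > 0` and bias `b`, there is
a two-bin equilibrium edge `m > 0` with `m = (E[M | M < m] + E[M | M ≥ m])/2 + b` if and only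
if `b > −1/(2λ)`. -/
theorem exp_twoBin_iff (lam b : ℝ) (hlam : 0 < lam) :
    (∃ m : ℝ, 0 < m ∧
      m = (condMean (expPDF lam) (Iio m) + condMean (expPDF lam) (Ici m)) / 2 + b) ↔
    b > -1 / (2 * lam) := by
  have hslope : 1 < 2 * (1 / lam + b) * lam ↔ b > -1 / (2 * lam) := by
    have h : 2 * (1 / lam + b) * lam = 2 + b * (2 * lam) := by field_simp
    rw [h, gt_iff_lt, div_lt_iff₀ (by positivity)]
    constructor <;> intro h <;> linarith
  rw [← hslope, ← exists_pos_eq_mul_one_sub_exp_iff hlam]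
  exact exists_congr fun m => and_congr_right fun hm => exp_twoBin_equation_iff hlam hm
end

section
/- Let M be exponentially distributed with parameter λ > 0 and let b > 0. Set c = 2/λ + 2b. Then: (i) there exists a unique l* ∈ (2b, 2/λ + 2b) satisfying (c − l*)·e^{λ l*} − (c + l*) = 0 (equivalently g(l*) = c − h(l*) with g(x) = x e^{λx}/(e^{λx} − 1), h(x) = x/(e^{λx} − 1)); (ii) the bin edges m_k = k·l* for k = 0, 1, 2, … form an equilibrium with infinitely many bins; and (iii) in any equilibrium with infinitely many bins all bin lengths equal l*, so this equilibrium is unique. -/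
open MeasureTheory Set Filter

/-- Equilibrium with infinitely many bins for a source on `[0, ∞)`: edges
`0 = m_0 < m_1 < m_2 < ⋯` with `m_k → ∞`, satisfying the centroid/nearest-neighbor condition
at every interior edge. -/
def IsEqInf (f : ℝ → ℝ) (b : ℝ) (m : ℕ → ℝ) : Prop :=
  m 0 = 0 ∧ StrictMono m ∧ Tendsto m atTop atTop ∧
  ∀ k : ℕ, m (k + 1) =
    (condMean f (Ico (m k) (m (k + 1))) + condMean f (Ico (m (k + 1)) (m (k + 2)))) / 2 + b

/-- The function `t ↦ t / (e ^ t - 1)`. -/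
noncomputable def divExpSubOne (t : ℝ) : ℝ := t / (Real.exp t - 1)

theorem exp_sub_one_pos {t : ℝ} (ht : 0 < t) : 0 < Real.exp t - 1 :=
  sub_pos.2 (Real.one_lt_exp_iff.2 ht)

theorem divExpSubOne_pos {t : ℝ} (ht : 0 < t) : 0 < divExpSubOne t :=
  div_pos ht (exp_sub_one_pos ht)

theorem divExpSubOne_lt_one {t : ℝ} (ht : 0 < t) : divExpSubOne t < 1 := by
  rw [divExpSubOne, div_lt_one (exp_sub_one_pos ht)]
  linarith [Real.add_one_lt_exp ht.ne']

theorem hasDerivAt_divExpSubOne {t : ℝ} (ht : 0 < t) :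
    HasDerivAt divExpSubOne
      ((1 * (Real.exp t - 1) - t * Real.exp t) / (Real.exp t - 1) ^ 2) t :=
  (hasDerivAt_id t).div ((Real.hasDerivAt_exp t).sub_const 1) (exp_sub_one_pos ht).ne'

theorem continuousOn_divExpSubOne : ContinuousOn divExpSubOne (Ioi 0) := fun _ ht =>
  (hasDerivAt_divExpSubOne ht).continuousAt.continuousWithinAt

theorem strictAntiOn_divExpSubOne : StrictAntiOn divExpSubOne (Ioi 0) := by
  refine strictAntiOn_of_deriv_neg (convex_Ioi 0) continuousOn_divExpSubOne fun t ht => ?_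
  rw [interior_Ioi] at ht
  have ht : 0 < t := ht
  rw [(hasDerivAt_divExpSubOne ht).deriv]
  refine div_neg_of_neg_of_pos ?_ (pow_pos (exp_sub_one_pos ht) 2)
  have h := Real.add_one_lt_exp (neg_ne_zero.2 ht.ne')
  have h' : Real.exp (-t) * Real.exp t = 1 := by rw [← Real.exp_add]; simp
  nlinarith [Real.exp_pos t]

theorem strictMonoOn_add_two_mul_divExpSubOne :
    StrictMonoOn (fun t => t + 2 * divExpSubOne t) (Ioi 0) := by
  refine strictMonoOn_of_deriv_pos (convex_Ioi 0)
    (continuousOn_id.add (continuousOn_const.mul continuousOn_divExpSubOne)) fun t ht => ?_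
  rw [interior_Ioi] at ht
  have ht : 0 < t := ht
  have hd := (hasDerivAt_id t).add ((hasDerivAt_divExpSubOne ht).const_mul 2)
  have hE := exp_sub_one_pos ht
  refine lt_of_lt_of_eq ?_ hd.deriv.symm
  have h1 : 1 + 2 * ((1 * (Real.exp t - 1) - t * Real.exp t) / (Real.exp t - 1) ^ 2)
      = (Real.exp t * Real.exp t - 1 - 2 * t * Real.exp t) / (Real.exp t - 1) ^ 2 := by
    field_simp
    ring
  rw [h1]
  refine div_pos ?_ (pow_pos hE 2)
  have h := Real.self_lt_sinh_iff.2 ht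
  rw [Real.sinh_eq] at h
  have h' : Real.exp (-t) * Real.exp t = 1 := by rw [← Real.exp_add]; simp
  nlinarith [Real.exp_pos t]

theorem exists_add_two_mul_divExpSubOne_eq {β : ℝ} (hβ : 0 < β) :
    ∃ t, β < t ∧ t < 2 + β ∧ t + 2 * divExpSubOne t = 2 + β := by
  have hcont : ContinuousOn (fun t => t + 2 * divExpSubOne t) (Icc β (2 + β)) :=
    (continuousOn_id.add (continuousOn_const.mul continuousOn_divExpSubOne)).mono
      fun t ht => hβ.trans_le ht.1
  have hlow := divExpSubOne_lt_one hβ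
  have hhigh := divExpSubOne_pos (t := 2 + β) (by linarith)
  obtain ⟨t, ht, hteq⟩ := intermediate_value_Ioo (by linarith) hcont
    (show 2 + β ∈ Ioo (β + 2 * divExpSubOne β) (2 + β + 2 * divExpSubOne (2 + β)) from
      ⟨by linarith, by linarith⟩)
  exact ⟨t, ht.1, ht.2, hteq⟩

theorem sub_mul_exp_sub_add_eq_zero_iff {c t : ℝ} (ht : 0 < t) :
    (c - t) * Real.exp t - (c + t) = 0 ↔ t + 2 * divExpSubOne t = c := by
  have hE := exp_sub_one_pos ht
  rw [divExpSubOne, ← sub_eq_zero (b := c)]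
  have h : t + 2 * (t / (Real.exp t - 1)) - c
      = -((c - t) * Real.exp t - (c + t)) / (Real.exp t - 1) := by
    field_simp
    ring
  rw [h, div_eq_zero_iff, neg_eq_zero, or_iff_left hE.ne']

theorem not_forall_add_le_succ {x : ℕ → ℝ} {ε B : ℝ} (hε : 0 < ε) (hB : ∀ k, x k ≤ B) :
    ¬ ∀ k, x k + ε ≤ x (k + 1) := by
  intro h
  have hlin : ∀ k : ℕ, x 0 + k * ε ≤ x k := by
    intro k
    induction k with
    | zero => simp
    | succ k ih => push_cast; linarith [h k]
  obtain ⟨n, hn⟩ := exists_nat_gt ((B - x 0) / ε)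
  rw [div_lt_iff₀ hε] at hn
  linarith [hlin n, hB n]

/-- The only positive solution of the recursion is the constant one: off the fixed point,
`divExpSubOne (t k)` would drift by at least a fixed amount at each step while staying in
`(0, 1)`. -/
theorem recursion_head_eq {C s : ℝ} (hs : 0 < s) (hfix : s + 2 * divExpSubOne s = C)
    {t : ℕ → ℝ} (ht : ∀ k, 0 < t k)
    (hrec : ∀ k, t k + divExpSubOne (t k) + divExpSubOne (t (k + 1)) = C) : t 0 = s := by
  have hmono := strictMonoOn_add_two_mul_divExpSubOne
  have hanti := strictAntiOn_divExpSubOne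
  rcases lt_trichotomy (t 0) s with hlt | heq | hgt
  · exfalso
    have hε : 0 < C - (t 0 + 2 * divExpSubOne (t 0)) := by
      have := hmono (ht 0) hs hlt
      simp only at this
      linarith
    have hle : ∀ k, t k ≤ t 0 → t (k + 1) ≤ t k := by
      intro k hk
      have := hmono.monotoneOn (ht k) (ht 0) hk
      exact (hanti.le_iff_ge (ht k) (ht (k + 1))).1 (by linarith [hrec k])
    have hall : ∀ k, t k ≤ t 0 := by
      intro k
      induction k with
      | zero => exact le_rfl
      | succ k ih => exact (hle k ih).trans ih
    refine not_forall_add_le_succ (x := fun k => divExpSubOne (t k)) hε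
      (fun k => (divExpSubOne_lt_one (ht k)).le) fun k => ?_
    have := hmono.monotoneOn (ht k) (ht 0) (hall k)
    linarith [hrec k]
  · exact heq
  · exfalso
    have hε : 0 < t 0 + 2 * divExpSubOne (t 0) - C := by
      have := hmono hs (ht 0) hgt
      simp only at this
      linarith
    have hle : ∀ k, t 0 ≤ t k → t k ≤ t (k + 1) := by
      intro k hk
      have := hmono.monotoneOn (ht 0) (ht k) hk
      exact (hanti.le_iff_ge (ht (k + 1)) (ht k)).1 (by linarith [hrec k])
    have hall : ∀ k, t 0 ≤ t k := by
      intro k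
      induction k with
      | zero => exact le_rfl
      | succ k ih => exact ih.trans (hle k ih)
    refine not_forall_add_le_succ (x := fun k => -divExpSubOne (t k)) (B := 0) hε
      (fun k => by simpa using (divExpSubOne_pos (ht k)).le) fun k => ?_
    have := hmono.monotoneOn (ht 0) (ht k) (hall k)
    linarith [hrec k]

theorem recursion_eq {C s : ℝ} (hs : 0 < s) (hfix : s + 2 * divExpSubOne s = C)
    {t : ℕ → ℝ} (ht : ∀ k, 0 < t k)
    (hrec : ∀ k, t k + divExpSubOne (t k) + divExpSubOne (t (k + 1)) = C) (k : ℕ) :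
    t k = s := by
  have h := recursion_head_eq (t := fun j => t (k + j)) hs hfix (fun j => ht _)
    fun j => hrec (k + j)
  exact h

theorem hasDerivAt_exp_neg_mul (lam x : ℝ) :
    HasDerivAt (fun x => Real.exp (-lam * x)) (Real.exp (-lam * x) * (-lam)) x := by
  simpa using ((hasDerivAt_id x).const_mul (-lam)).exp

theorem setIntegral_Ico_expPDF {lam a c : ℝ} (ha : 0 ≤ a) (hac : a ≤ c) :
    ∫ x in Ico a c, expPDF lam x = Real.exp (-lam * a) - Real.exp (-lam * c) := by
  have h : ∫ x in Ico a c, expPDF lam x = ∫ x in Ico a c, lam * Real.exp (-lam * x) :=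
    setIntegral_congr_fun measurableSet_Ico fun x hx => if_pos (ha.trans hx.1)
  rw [h, integral_Ico_eq_integral_Ioc, ← intervalIntegral.integral_of_le hac,
    intervalIntegral.integral_eq_sub_of_hasDerivAt (f := fun x => -Real.exp (-lam * x))]
  · ring
  · intro x _
    exact (hasDerivAt_exp_neg_mul lam x).neg.congr_deriv (by ring)
  · exact Continuous.intervalIntegrable (by fun_prop) _ _

theorem setIntegral_Ico_mul_expPDF {lam a c : ℝ} (hlam : lam ≠ 0) (ha : 0 ≤ a) (hac : a ≤ c) :
    ∫ x in Ico a c, x * expPDF lam x =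
      (a + 1 / lam) * Real.exp (-lam * a) - (c + 1 / lam) * Real.exp (-lam * c) := by
  have h : ∫ x in Ico a c, x * expPDF lam x
      = ∫ x in Ico a c, x * (lam * Real.exp (-lam * x)) :=
    setIntegral_congr_fun measurableSet_Ico fun x hx =>
      congrArg (x * ·) (if_pos (ha.trans hx.1))
  rw [h, integral_Ico_eq_integral_Ioc, ← intervalIntegral.integral_of_le hac,
    intervalIntegral.integral_eq_sub_of_hasDerivAt
      (f := fun x => -((x + 1 / lam) * Real.exp (-lam * x)))]
  · ring
  · intro x _
    refine (((hasDerivAt_id x).add_const (1 / lam)).mul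
      (hasDerivAt_exp_neg_mul lam x)).neg.congr_deriv ?_
    simp only [id]
    field_simp
    ring
  · exact Continuous.intervalIntegrable (by fun_prop) _ _

theorem condMean_expPDF_Ico {lam a c : ℝ} (hlam : 0 < lam) (ha : 0 ≤ a) (hac : a < c) :
    condMean (expPDF lam) (Ico a c)
      = 1 / lam + a - divExpSubOne (lam * (c - a)) / lam := by
  have hE := exp_sub_one_pos (mul_pos hlam (sub_pos.2 hac))
  have hexp : Real.exp (-lam * a) = Real.exp (lam * (c - a)) * Real.exp (-lam * c) := by
    rw [← Real.exp_add]
    congr 1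
    ring
  rw [condMean, setIntegral_Ico_expPDF ha hac.le, setIntegral_Ico_mul_expPDF hlam.ne' ha hac.le,
    hexp, divExpSubOne]
  generalize Real.exp (lam * (c - a)) = E at hE
  have hc := Real.exp_pos (-lam * c)
  generalize Real.exp (-lam * c) = F at hc
  have hden : E * F - F = (E - 1) * F := by ring
  rw [hden]
  have hE' := hE.ne'
  field_simp
  ring

theorem expPDF_edge_iff {lam b x y z : ℝ} (hlam : 0 < lam) (hx : 0 ≤ x) (hxy : x < y)
    (hyz : y < z) :
    y = (condMean (expPDF lam) (Ico x y) + condMean (expPDF lam) (Ico y z)) / 2 + b ↔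
      lam * (y - x) + divExpSubOne (lam * (y - x)) + divExpSubOne (lam * (z - y))
        = 2 + 2 * (lam * b) := by
  rw [condMean_expPDF_Ico hlam hx hxy, condMean_expPDF_Ico hlam (hx.trans hxy.le) hyz]
  generalize divExpSubOne (lam * (y - x)) = p
  generalize divExpSubOne (lam * (z - y)) = q
  field_simp
  constructor <;> intro h <;> linarith

/-- For an exponential source with parameter `λ > 0` and bias `b > 0`, with
`c = 2/λ + 2b`: (i) there is a unique `l* ∈ (2b, 2/λ + 2b)` with
`(c − l*)e^{λl*} − (c + l*) = 0`; (ii) the edges `m_k = k·l*` form an equilibrium with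
infinitely many bins; (iii) any equilibrium with infinitely many bins has all bin lengths
equal to `l*`, so this equilibrium is unique. -/
theorem exp_infinite_equilibrium (lam b : ℝ) (hlam : 0 < lam) (hb : 0 < b) :
    ∃ l : ℝ,
      (2 * b < l ∧ l < 2 / lam + 2 * b ∧
        ((2 / lam + 2 * b) - l) * Real.exp (lam * l) - ((2 / lam + 2 * b) + l) = 0) ∧
      (∀ l' : ℝ, 2 * b < l' → l' < 2 / lam + 2 * b →
        ((2 / lam + 2 * b) - l') * Real.exp (lam * l') - ((2 / lam + 2 * b) + l') = 0 →
        l' = l) ∧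
      IsEqInf (expPDF lam) b (fun k : ℕ => (k : ℝ) * l) ∧
      (∀ m : ℕ → ℝ, IsEqInf (expPDF lam) b m → ∀ k : ℕ, m (k + 1) - m k = l) := by
  have hβ : 0 < 2 * (lam * b) := by positivity
  obtain ⟨s, hs1, hs2, hs⟩ := exists_add_two_mul_divExpSubOne_eq hβ
  have hs0 : 0 < s := hβ.trans hs1
  have hscale : ∀ x, (2 / lam + 2 * b - x) * Real.exp (lam * x) - (2 / lam + 2 * b + x)
      = ((2 + 2 * (lam * b) - lam * x) * Real.exp (lam * x)
          - (2 + 2 * (lam * b) + lam * x)) / lam := by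
    intro x
    field_simp
  have hiff : ∀ x, 0 < x →
      ((2 / lam + 2 * b - x) * Real.exp (lam * x) - (2 / lam + 2 * b + x) = 0 ↔
        lam * x + 2 * divExpSubOne (lam * x) = 2 + 2 * (lam * b)) := by
    intro x hx
    rw [hscale, div_eq_zero_iff, or_iff_left hlam.ne',
      sub_mul_exp_sub_add_eq_zero_iff (mul_pos hlam hx)]
  have hl0 : 0 < s / lam := div_pos hs0 hlam
  have hls : lam * (s / lam) = s := mul_div_cancel₀ s hlam.ne'
  refine ⟨s / lam, ⟨?_, ?_, ?_⟩, ?_, ⟨?_, ?_, ?_, ?_⟩, ?_⟩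
  · rw [lt_div_iff₀ hlam]
    linarith
  · rw [div_lt_iff₀ hlam, add_mul, div_mul_cancel₀ _ hlam.ne']
    linarith
  · rw [hiff _ hl0, hls]
    exact hs
  · intro l' hl' _ heq
    have hl'0 : 0 < l' := by linarith
    rw [hiff _ hl'0] at heq
    rw [eq_div_iff hlam.ne', mul_comm]
    exact strictMonoOn_add_two_mul_divExpSubOne.injOn (mul_pos hlam hl'0) hs0 (heq.trans hs.symm)
  · simp
  · exact fun i j hij => mul_lt_mul_of_pos_right (Nat.cast_lt.2 hij) hl0
  · exact tendsto_natCast_atTop_atTop.atTop_mul_const hl0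
  · intro k
    refine (expPDF_edge_iff hlam (by positivity) ?_ ?_).2 ?_
    · push_cast
      linarith
    · push_cast
      linarith
    · have h1 : lam * (((k + 1 : ℕ) : ℝ) * (s / lam) - (k : ℝ) * (s / lam)) = s := by
        rw [← sub_mul]
        push_cast
        rw [add_sub_cancel_left, one_mul, hls]
      have h2 : lam * (((k + 2 : ℕ) : ℝ) * (s / lam) - ((k + 1 : ℕ) : ℝ) * (s / lam)) = s := by
        rw [← sub_mul]
        push_cast
        rw [add_sub_add_left_eq_sub, show (2 : ℝ) - 1 = 1 by norm_num, one_mul, hls]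
      rw [h1, h2]
      linarith
  · rintro m ⟨h0, hm, -, hedge⟩ k
    have hnonneg : ∀ j, 0 ≤ m j := fun j => h0 ▸ hm.monotone (Nat.zero_le j)
    rw [eq_div_iff hlam.ne', mul_comm]
    exact recursion_eq (t := fun j => lam * (m (j + 1) - m j)) hs0 hs
      (fun j => mul_pos hlam (sub_pos.2 (hm j.lt_succ_self)))
      (fun j => (expPDF_edge_iff hlam (hnonneg j) (hm j.lt_succ_self)
        (hm (j + 1).lt_succ_self)).1 (hedge j)) k
end
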